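/- For every natural number d ≥ 1, the maximum over x ∈ H_d of the distance D_d(x) from x to the nearest point of A*_d equals sqrt(d(d+2)/(12(d+1))); that is, the covering radius of the lattice A*_d is sqrt(d(d+2)/(12(d+1))). -/

import Mathlib

/-- The hyperplane `H_d = {x ∈ ℝ^(d+1) : ∑ x_i = 0}`. -/
def hyperplaneH (d : ℕ) : Set (EuclideanSpace ℝ (Fin (d + 1))) :=
  {x | ∑ i, x i = 0}

/-- The permutohedral lattice `A*_d`: all points of `H_d` whose coordinate
differences are integers. -/
def Astar (d : ℕ) : Set (EuclideanSpace ℝ (Fin (d + 1))) :=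
  {x | x ∈ hyperplaneH d ∧ ∀ i j, ∃ k : ℤ, x i - x j = (k : ℝ)}

lemma zero_mem_Astar (d : ℕ) : (0 : EuclideanSpace ℝ (Fin (d + 1))) ∈ Astar d :=
  ⟨by simp [hyperplaneH], fun i j => ⟨0, by simp⟩⟩

lemma isClosed_Astar (d : ℕ) : IsClosed (Astar d) := by
  have h : Astar d = {x | ∑ i, x i = 0} ∩
      ⋂ i, ⋂ j, (fun x : EuclideanSpace ℝ (Fin (d + 1)) => x i - x j) ⁻¹'
        Set.range ((↑) : ℤ → ℝ) := by
    ext x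
    simp only [Astar, hyperplaneH, Set.mem_ofPred_eq, Set.mem_inter_iff, Set.mem_iInter,
      Set.mem_preimage, Set.mem_range, eq_comm]
  rw [h]
  refine (isClosed_eq (by fun_prop) continuous_const).inter ?_
  exact isClosed_iInter fun i => isClosed_iInter fun j =>
    Int.isClosedEmbedding_coe_real.isClosed_range.preimage (by fun_prop)

/-- The deep hole of `A*_d` with increasing equally spaced coordinates. -/
noncomputable def deepHole (d : ℕ) : EuclideanSpace ℝ (Fin (d + 1)) :=
  WithLp.toLp 2 fun i => (2 * (i : ℝ) - d) / (2 * (d + 1))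

lemma deepHole_apply (d : ℕ) (i : Fin (d + 1)) :
    deepHole d i = (2 * (i : ℝ) - d) / (2 * (d + 1)) := rfl

lemma sum_range_deepHole (d m : ℕ) :
    ∑ i ∈ Finset.range m, (2 * (i : ℝ) - d) / (2 * (d + 1)) =
      -(m * ((d : ℝ) + 1 - m)) / (2 * (d + 1)) := by
  induction m with
  | zero => simp
  | succ m ih => rw [Finset.sum_range_succ, ih]; push_cast; field_simp; ring

lemma deepHole_mem (d : ℕ) : deepHole d ∈ hyperplaneH d := by
  change ∑ i : Fin (d + 1), (2 * (i : ℝ) - d) / (2 * (d + 1)) = 0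
  rw [Fin.sum_univ_eq_sum_range (fun i : ℕ => (2 * (i : ℝ) - d) / (2 * (d + 1))),
    sum_range_deepHole]
  simp

lemma sum_sq_deepHole (d : ℕ) :
    ∑ i, deepHole d i ^ 2 = (d : ℝ) * (d + 2) / (12 * (d + 1)) := by
  have h (m : ℕ) : ∑ i ∈ Finset.range m, ((2 * (i : ℝ) - d) / (2 * (d + 1))) ^ 2 =
      (2 * m * (m - 1) * (2 * m - 1) / 3 - 2 * d * m * (m - 1) + m * (d : ℝ) ^ 2) /
        (4 * (d + 1) ^ 2) := by
    induction m with
    | zero => simp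
    | succ m ih => rw [Finset.sum_range_succ, ih]; push_cast; field_simp; ring
  simp only [deepHole_apply]
  rw [Fin.sum_univ_eq_sum_range (fun i : ℕ => ((2 * (i : ℝ) - d) / (2 * (d + 1))) ^ 2), h]
  push_cast
  field_simp
  ring

/-- Twice the pairing of `v` with the deep hole, as a sum over pairs of coordinates. -/
lemma sum_deepHole_mul (d : ℕ) (v : Fin (d + 1) → ℝ) :
    ∑ i, ∑ j, (if j < i then v i - v j else 0) =
      2 * (d + 1) * ∑ i, deepHole d i * v i := by
  have h1 (i : Fin (d + 1)) : ∑ j, (if j < i then v i else 0) = i * v i := by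
    rw [← Finset.sum_filter, Finset.sum_const, nsmul_eq_mul, Finset.filter_gt_eq_Iio,
      Fin.card_Iio]
  have h2 (j : Fin (d + 1)) : ∑ i, (if j < i then v j else 0) = (d - j) * v j := by
    rw [← Finset.sum_filter, Finset.sum_const, nsmul_eq_mul, Finset.filter_lt_eq_Ioi,
      Fin.card_Ioi, Nat.cast_sub (by omega)]
    simp
  calc ∑ i, ∑ j, (if j < i then v i - v j else 0)
      = ∑ i, ∑ j, (if j < i then v i else 0) - ∑ i, ∑ j, (if j < i then v j else 0) := by
        simp only [← Finset.sum_sub_distrib]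
        refine Finset.sum_congr rfl fun i _ => Finset.sum_congr rfl fun j _ => ?_
        split_ifs <;> simp
    _ = ∑ i : Fin (d + 1), ((i : ℝ) * v i - (d - i) * v i) := by
        rw [Finset.sum_comm (f := fun i j => if j < i then v j else 0)]
        simp only [h1, h2, Finset.sum_sub_distrib]
    _ = _ := by
        rw [Finset.mul_sum]
        refine Finset.sum_congr rfl fun i _ => ?_
        rw [deepHole_apply]
        field_simp
        ring

lemma sum_sq_sub {ι : Type*} [Fintype ι] (v : ι → ℝ) (hv : ∑ i, v i = 0) :
    ∑ i, ∑ j, (v i - v j) ^ 2 = 2 * Fintype.card ι * ∑ i, v i ^ 2 := by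
  have h (i : ι) : ∑ j, (v i - v j) ^ 2 = Fintype.card ι * v i ^ 2 + ∑ j, v j ^ 2 := by
    calc ∑ j, (v i - v j) ^ 2 = ∑ j, (v i ^ 2 - 2 * v i * v j + v j ^ 2) :=
          Finset.sum_congr rfl fun j _ => by ring
      _ = _ := by
          rw [Finset.sum_add_distrib, Finset.sum_sub_distrib, ← Finset.mul_sum, hv]
          simp
  simp only [h, Finset.sum_add_distrib, ← Finset.mul_sum, Finset.sum_const, Finset.card_univ,
    nsmul_eq_mul]
  ring

lemma two_mul_sum_deepHole_le {d : ℕ} {v : EuclideanSpace ℝ (Fin (d + 1))} (hv : v ∈ Astar d) :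
    2 * ∑ i, deepHole d i * v i ≤ ∑ i, v i ^ 2 := by
  have hpair : 2 * ∑ i, ∑ j, (if j < i then v i - v j else 0) ≤ ∑ i, ∑ j, (v i - v j) ^ 2 := by
    have hswap : ∑ i, ∑ j, (if j < i then v i - v j else 0) =
        ∑ i, ∑ j, (if i < j then v j - v i else 0) := Finset.sum_comm
    rw [two_mul]
    nth_rewrite 2 [hswap]
    simp only [← Finset.sum_add_distrib]
    refine Finset.sum_le_sum fun i _ => Finset.sum_le_sum fun j _ => ?_
    obtain ⟨k, hk⟩ := hv.2 i j
    have h1 : (k : ℝ) ≤ (k : ℝ) ^ 2 := by exact_mod_cast Int.le_self_sq k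
    have h2 : -(k : ℝ) ≤ (k : ℝ) ^ 2 := by
      have := Int.le_self_sq (-k)
      rw [neg_sq] at this
      exact_mod_cast this
    have h3 : v j - v i = -(k : ℝ) := by linarith
    rw [hk, h3]
    split_ifs with h h' h'
    · exact absurd h' h.asymm
    · simpa using h1
    · simpa using h2
    · simpa using sq_nonneg (k : ℝ)
  rw [sum_deepHole_mul, sum_sq_sub _ hv.1, Fintype.card_fin] at hpair
  push_cast at hpair
  have hd : (0 : ℝ) < 2 * (d + 1) := by positivity
  refine le_of_mul_le_mul_left ?_ hd
  linarith

lemma le_dist_deepHole {d : ℕ} {v : EuclideanSpace ℝ (Fin (d + 1))} (hv : v ∈ Astar d) :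
    √((d : ℝ) * (d + 2) / (12 * (d + 1))) ≤ dist (deepHole d) v := by
  rw [EuclideanSpace.dist_eq]
  refine Real.sqrt_le_sqrt ?_
  simp only [Real.dist_eq, sq_abs, sub_sq, Finset.sum_add_distrib, Finset.sum_sub_distrib,
    sum_sq_deepHole, mul_assoc, ← Finset.mul_sum]
  linarith [two_mul_sum_deepHole_le hv]

/-- Abel's inequality: pairing a monotone sequence with one whose partial sums are nonpositive. -/
lemma sum_mul_ge_of_sum_nonpos {a u : ℕ → ℝ} (hu : Monotone u) (m : ℕ)
    (ha : ∀ k ≤ m, ∑ i ∈ Finset.range k, a i ≤ 0) :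
    (∑ i ∈ Finset.range (m + 1), a i) * u m ≤ ∑ i ∈ Finset.range (m + 1), a i * u i := by
  induction m with
  | zero => simp
  | succ m ih =>
    rw [Finset.sum_range_succ, Finset.sum_range_succ (fun i => a i * u i)]
    have h1 := ih fun k hk => ha k (by omega)
    have h2 := mul_le_mul_of_nonpos_left (hu m.le_succ) (ha (m + 1) le_rfl)
    linarith

/-- Vectors of the Voronoi cell: the sum of any `m` coordinates is at least
`-m (d + 1 - m) / (2 (d + 1))`. -/
lemma sum_ge_of_forall_dist_le {d : ℕ} {x v : EuclideanSpace ℝ (Fin (d + 1))}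
    (hx : x ∈ hyperplaneH d) (hv : v ∈ Astar d) (hmin : ∀ y ∈ Astar d, dist x v ≤ dist x y)
    (s : Finset (Fin (d + 1))) :
    -((s.card : ℝ) * (d + 1 - s.card)) / (2 * (d + 1)) ≤ ∑ i ∈ s, (x i - v i) := by
  have hd : (d : ℝ) + 1 ≠ 0 := by positivity
  set r : ℝ := s.card / (d + 1) with hr
  have hrd : (d + 1) * r = s.card := by rw [hr]; field_simp
  set e : Fin (d + 1) → ℝ := fun i => if i ∈ s then 1 else 0
  have he : ∑ i, e i = s.card := by simp [e]
  let y : EuclideanSpace ℝ (Fin (d + 1)) := WithLp.toLp 2 fun i => v i - (e i - r)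
  have hvs : ∑ i, v i = 0 := hv.1
  have hxs : ∑ i, x i = 0 := hx
  have hy : y ∈ Astar d := by
    refine ⟨?_, fun i j => ?_⟩
    · change ∑ i, (v i - (e i - r)) = 0
      rw [Finset.sum_sub_distrib, Finset.sum_sub_distrib, he, hvs]
      simp [hrd]
    · obtain ⟨k, hk⟩ := hv.2 i j
      refine ⟨k - (if i ∈ s then 1 else 0) + (if j ∈ s then 1 else 0), ?_⟩
      change v i - (e i - r) - (v j - (e j - r)) = _
      push_cast
      rw [← hk]
      ring
  have h := hmin y hy
  rw [EuclideanSpace.dist_eq, EuclideanSpace.dist_eq, Real.sqrt_le_sqrt_iff (by positivity)] at h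
  simp only [Real.dist_eq, sq_abs] at h
  have hexp : ∑ i, (x i - y i) ^ 2 =
      ∑ i, (x i - v i) ^ 2 + 2 * ∑ i ∈ s, (x i - v i) + s.card - 2 * r * s.card
        + (d + 1) * r ^ 2 := by
    have hs : ∑ i ∈ s, (x i - v i) = ∑ i, e i * (x i - v i) := by simp [e]
    have hi (i) : (x i - y i) ^ 2 = (x i - v i) ^ 2 + 2 * (e i * (x i - v i)) + e i
        - 2 * r * e i + r ^ 2 - 2 * r * (x i - v i) := by
      have hee : e i ^ 2 = e i := by simp [e]
      change (x i - (v i - (e i - r))) ^ 2 = _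
      linear_combination hee
    simp only [hi, Finset.sum_add_distrib, Finset.sum_sub_distrib, ← Finset.mul_sum, he, hs,
      hvs, hxs]
    simp
  rw [hexp] at h
  have hfin : -((s.card : ℝ) * (d + 1 - s.card)) / (2 * (d + 1)) = (r * s.card - s.card) / 2 := by
    rw [hr]; field_simp; ring
  rw [hfin]
  have : (d + 1) * r ^ 2 = r * s.card := by rw [← hrd]; ring
  linarith

lemma sum_sq_le_of_forall_sum_ge {d : ℕ} {w : Fin (d + 1) → ℝ} (hw : ∑ i, w i = 0)
    (h : ∀ s : Finset (Fin (d + 1)),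
      -((s.card : ℝ) * (d + 1 - s.card)) / (2 * (d + 1)) ≤ ∑ i ∈ s, w i) :
    ∑ i, w i ^ 2 ≤ (d : ℝ) * (d + 2) / (12 * (d + 1)) := by
  set σ := Tuple.sort w
  have hmono : Monotone (w ∘ σ) := Tuple.monotone_sort w
  set u : ℕ → ℝ := fun k => w (σ ⟨min k d, by omega⟩) with hu
  have hu_mono : Monotone u := fun a b hab => hmono (by simp only [Fin.mk_le_mk]; omega)
  have hu_fin (i : Fin (d + 1)) : u i = w (σ i) := by
    have : (⟨min (i : ℕ) d, by omega⟩ : Fin (d + 1)) = i := Fin.ext (by simp; omega)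
    simp only [hu, this]
  set c : ℕ → ℝ := fun i => (2 * (i : ℝ) - d) / (2 * (d + 1)) with hc
  have hprefix (k : ℕ) (hk : k ≤ d + 1) : ∑ i ∈ Finset.range k, (c i - u i) ≤ 0 := by
    have hinj : Function.Injective fun i : Fin k => σ (Fin.castLE hk i) :=
      σ.injective.comp (Fin.castLE_injective hk)
    have hs := h (Finset.univ.map ⟨_, hinj⟩)
    rw [Finset.sum_map, Finset.card_map, Finset.card_univ, Fintype.card_fin] at hs
    rw [Finset.sum_sub_distrib, sum_range_deepHole, ← Fin.sum_univ_eq_sum_range u, sub_nonpos]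
    refine hs.trans_eq (Finset.sum_congr rfl fun i _ => ?_)
    exact (hu_fin (Fin.castLE hk i)).symm
  have hsum (f : ℝ → ℝ) : ∑ i : Fin (d + 1), f (u i) = ∑ i, f (w i) := by
    simp only [hu_fin]
    exact Equiv.sum_comp σ fun i => f (w i)
  have htotal : ∑ i ∈ Finset.range (d + 1), (c i - u i) = 0 := by
    rw [Finset.sum_sub_distrib, sum_range_deepHole, ← Fin.sum_univ_eq_sum_range u,
      hsum fun t => t, hw]
    simp
  have hAbel := sum_mul_ge_of_sum_nonpos hu_mono d fun k hk => hprefix k (by omega)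
  rw [htotal, zero_mul] at hAbel
  have hsq : ∑ i ∈ Finset.range (d + 1), (c i - u i) * u i ≤
      (∑ i ∈ Finset.range (d + 1), c i ^ 2 - ∑ i ∈ Finset.range (d + 1), u i ^ 2) / 2 := by
    rw [← Finset.sum_sub_distrib, Finset.sum_div]
    exact Finset.sum_le_sum fun i _ => by nlinarith [sq_nonneg (c i - u i)]
  have hcsq : ∑ i ∈ Finset.range (d + 1), c i ^ 2 = (d : ℝ) * (d + 2) / (12 * (d + 1)) := by
    rw [← sum_sq_deepHole, ← Fin.sum_univ_eq_sum_range fun i => c i ^ 2]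
    rfl
  rw [← hsum fun t => t ^ 2, Fin.sum_univ_eq_sum_range fun i => u i ^ 2]
  linarith

lemma infDist_Astar_le {d : ℕ} {x : EuclideanSpace ℝ (Fin (d + 1))} (hx : x ∈ hyperplaneH d) :
    Metric.infDist x (Astar d) ≤ √((d : ℝ) * (d + 2) / (12 * (d + 1))) := by
  obtain ⟨v, hv, hxv⟩ := (isClosed_Astar d).exists_infDist_eq_dist ⟨0, zero_mem_Astar d⟩ x
  rw [hxv, EuclideanSpace.dist_eq]
  refine Real.sqrt_le_sqrt ?_
  simp only [Real.dist_eq, sq_abs]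
  refine sum_sq_le_of_forall_sum_ge ?_ fun s => sum_ge_of_forall_dist_le hx hv ?_ s
  · have h1 : ∑ i, x i = 0 := hx
    have h2 : ∑ i, v i = 0 := hv.1
    rw [Finset.sum_sub_distrib, h1, h2, sub_zero]
  · exact fun y hy => hxv ▸ Metric.infDist_le_dist_of_mem hy

/-- For every `d ≥ 1`, the maximum over `x ∈ H_d` of the distance from `x` to the
nearest point of `A*_d` (the covering radius of `A*_d`) equals
`√(d(d+2)/(12(d+1)))`. -/
theorem covering_radius_eq (d : ℕ) (hd : 1 ≤ d) :
    IsGreatest ((fun x => Metric.infDist x (Astar d)) '' hyperplaneH d)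
      (Real.sqrt ((d : ℝ) * ((d : ℝ) + 2) / (12 * ((d : ℝ) + 1)))) := by
  refine ⟨⟨deepHole d, deepHole_mem d, (infDist_Astar_le (deepHole_mem d)).antisymm ?_⟩, ?_⟩
  · exact (Metric.le_infDist ⟨0, zero_mem_Astar d⟩).2 fun _ hy => le_dist_deepHole hy
  · rintro _ ⟨x, hx, rfl⟩
    exact infDist_Astar_le hx
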